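/- Two-sided control of the suboptimality gap by the duality gap when μ_Ω > 0: let f : ℝⁿ → ℝ be convex, differentiable and ν_f-smooth, let Ω : ℝᵖ → ℝ ∪ {+∞} be proper, closed, convex and μ_Ω-strongly convex with μ_Ω > 0, let X ∈ ℝ^{n×p} with squared spectral norm σ_X := ‖X‖²_{op}, and let β̂ minimize P(β) = f(Xβ) + Ω(β). For β ∈ dom Ω set θ := −∇f(Xβ) and assume −θ ∈ dom f*. Then with s := μ_Ω/(σ_X ν_f + μ_Ω) one has s · Gap(β, θ) ≤ P(β) − P(β̂) ≤ Gap(β, θ). -/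

import Mathlib

noncomputable section

/-- Fenchel conjugate of an extended-real-valued function. -/
def fconj {m : ℕ} (h : EuclideanSpace ℝ (Fin m) → EReal) (v : EuclideanSpace ℝ (Fin m)) : EReal :=
  ⨆ x, ((inner ℝ v x : ℝ) : EReal) - h x

/-- Fenchel conjugate of a real-valued function. -/
def fconjR {m : ℕ} (h : EuclideanSpace ℝ (Fin m) → ℝ) (v : EuclideanSpace ℝ (Fin m)) : EReal :=
  ⨆ x, (((inner ℝ v x : ℝ) - h x : ℝ) : EReal)

/-- Convexity for an extended-real-valued function. -/
def ERealConvexOn {m : ℕ} (h : EuclideanSpace ℝ (Fin m) → EReal) : Prop :=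
  ∀ x y : EuclideanSpace ℝ (Fin m), ∀ a b : ℝ, 0 ≤ a → 0 ≤ b → a + b = 1 →
    h (a • x + b • y) ≤ (a : EReal) * h x + (b : EReal) * h y

/-- `X v` for a matrix `X ∈ ℝ^{n×p}` and `v ∈ ℝᵖ`. -/
def mv {n p : ℕ} (X : Matrix (Fin n) (Fin p) ℝ) (v : EuclideanSpace ℝ (Fin p)) :
    EuclideanSpace ℝ (Fin n) :=
  WithLp.toLp 2 fun i => ∑ j, X i j * v j

/-- `X^⊤ θ` for a matrix `X ∈ ℝ^{n×p}` and `θ ∈ ℝⁿ`. -/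
def mvT {n p : ℕ} (X : Matrix (Fin n) (Fin p) ℝ) (θ : EuclideanSpace ℝ (Fin n)) :
    EuclideanSpace ℝ (Fin p) :=
  WithLp.toLp 2 fun j => ∑ i, X i j * θ i

/-- Operator (spectral) norm of a matrix acting between Euclidean spaces. -/
def opNorm {n p : ℕ} (X : Matrix (Fin n) (Fin p) ℝ) : ℝ :=
  ‖LinearMap.toContinuousLinearMap (Matrix.toEuclideanLin X)‖

theorem aux_line {m : ℕ} (f : EuclideanSpace ℝ (Fin m) → ℝ)
    (g : EuclideanSpace ℝ (Fin m) → EuclideanSpace ℝ (Fin m))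
    (hg : ∀ x, HasGradientAt f (g x) x) (y d : EuclideanSpace ℝ (Fin m)) (t : ℝ) :
    HasDerivAt (fun t : ℝ => f (y + t • d)) (inner ℝ (g (y + t • d)) d) t := by
  have h1 := (hg (y + t • d)).hasFDerivAt
  have h2 : HasDerivAt (fun t : ℝ => y + t • d) d t := by
    simpa using ((hasDerivAt_id t).smul_const d).const_add y
  have h3 := h1.comp_hasDerivAt t h2
  have e : (InnerProductSpace.toDual ℝ (EuclideanSpace ℝ (Fin m)) (g (y + t • d))) d
      = inner ℝ (g (y + t • d)) d := by simp
  rw [← e]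
  exact h3

theorem aux_tangent {m : ℕ} (f : EuclideanSpace ℝ (Fin m) → ℝ)
    (hc : ConvexOn ℝ Set.univ f)
    (g : EuclideanSpace ℝ (Fin m) → EuclideanSpace ℝ (Fin m))
    (hg : ∀ x, HasGradientAt f (g x) x) (y x : EuclideanSpace ℝ (Fin m)) :
    f y + inner ℝ (g y) (x - y) ≤ f x := by
  have h1 := aux_line f g hg y (x - y) 0
  have hcv : ConvexOn ℝ Set.univ (fun t : ℝ => f (y + t • (x - y))) := by
    refine ⟨convex_univ, ?_⟩
    intro a _ b _ u v hu hv huv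
    have := hc.2 (Set.mem_univ (y + a • (x - y))) (Set.mem_univ (y + b • (x - y))) hu hv huv
    convert this using 2
    have : y = (u + v) • y := by rw [huv, one_smul]
    nth_rewrite 1 [this]
    simp only [smul_eq_mul]
    module
  have := hcv.le_slope_of_hasDerivAt (Set.mem_univ 0) (Set.mem_univ 1) zero_lt_one h1
  simp [slope_def_field] at this
  linarith

theorem aux_descent {m : ℕ} (f : EuclideanSpace ℝ (Fin m) → ℝ)
    (g : EuclideanSpace ℝ (Fin m) → EuclideanSpace ℝ (Fin m))
    (hg : ∀ x, HasGradientAt f (g x) x) (ν : ℝ)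
    (hs : ∀ x y, ‖g x - g y‖ ≤ ν * ‖x - y‖) (y d : EuclideanSpace ℝ (Fin m)) :
    f (y + d) ≤ f y + inner ℝ (g y) d + ν / 2 * ‖d‖ ^ 2 := by
  have hd : ∀ t : ℝ, HasDerivAt
      (fun t : ℝ => f (y + t • d) - t * inner ℝ (g y) d - ν / 2 * ‖d‖ ^ 2 * t ^ 2)
      (inner ℝ (g (y + t • d)) d - inner ℝ (g y) d - ν * ‖d‖ ^ 2 * t) t := by
    intro t
    have h1 := aux_line f g hg y d t
    have h2 := (hasDerivAt_id t).mul_const (inner ℝ (g y) d)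
    have h3 := ((hasDerivAt_id t).pow 2).const_mul (ν / 2 * ‖d‖ ^ 2)
    refine ((h1.sub h2).sub h3).congr_deriv ?_
    simp
    ring
  have := antitoneOn_of_deriv_nonpos (convex_Icc (0 : ℝ) 1)
    (fun t _ => (hd t).continuousAt.continuousWithinAt)
    (fun t _ => (hd t).differentiableAt.differentiableWithinAt)
    (fun t ht => by
      rw [(hd t).deriv]
      have ht0 : 0 ≤ t := by
        rw [interior_Icc] at ht
        exact ht.1.le
      have h1 := real_inner_le_norm (g (y + t • d) - g y) d
      have h2 := hs (y + t • d) y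
      rw [add_sub_cancel_left, norm_smul, Real.norm_of_nonneg ht0] at h2
      have h3 := mul_le_mul_of_nonneg_right h2 (norm_nonneg d)
      rw [inner_sub_left] at h1
      nlinarith)
    (Set.left_mem_Icc.2 zero_le_one) (Set.right_mem_Icc.2 zero_le_one) zero_le_one
  simp at this
  linarith

theorem aux_mv {n p : ℕ} (X : Matrix (Fin n) (Fin p) ℝ) (v : EuclideanSpace ℝ (Fin p)) :
    mv X v = LinearMap.toContinuousLinearMap (Matrix.toEuclideanLin X) v := by
  ext i
  simp [mv, Matrix.toLpLin_apply, Matrix.mulVec, dotProduct]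

theorem aux_mvT {n p : ℕ} (X : Matrix (Fin n) (Fin p) ℝ) (θ : EuclideanSpace ℝ (Fin n))
    (v : EuclideanSpace ℝ (Fin p)) :
    inner ℝ (mvT X θ) v = inner ℝ θ (mv X v) := by
  simp only [mv, mvT, PiLp.inner_apply, RCLike.inner_apply, conj_trivial, Finset.mul_sum,
    Finset.sum_mul]
  rw [Finset.sum_comm]
  refine Finset.sum_congr rfl fun i _ => Finset.sum_congr rfl fun j _ => ?_
  ring

theorem aux_strong {p : ℕ} (Ω : EuclideanSpace ℝ (Fin p) → EReal)
    (hbot : ∀ x, Ω x ≠ ⊥) (μ : ℝ)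
    (hst : ERealConvexOn (fun b => Ω b - ((μ / 2 * ‖b‖ ^ 2 : ℝ) : EReal)))
    (x y : EuclideanSpace ℝ (Fin p)) (a b : ℝ) (hx : Ω x = a) (hy : Ω y = b)
    (s : ℝ) (h0 : 0 ≤ s) (h1 : s ≤ 1) :
    ∃ c : ℝ, Ω (x + s • (y - x)) = c ∧
      c ≤ (1 - s) * a + s * b - μ / 2 * (s * (1 - s)) * ‖y - x‖ ^ 2 := by
  have h := hst x y (1 - s) s (by linarith) h0 (by ring)
  have e : (1 - s) • x + s • y = x + s • (y - x) := by module
  simp only [hx, hy] at h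
  rw [e] at h
  have hn : ‖x + s • (y - x)‖ ^ 2
      = (1 - s) * ‖x‖ ^ 2 + s * ‖y‖ ^ 2 - s * (1 - s) * ‖y - x‖ ^ 2 := by
    rw [norm_add_sq_real, norm_smul, norm_sub_sq_real, inner_smul_right, inner_sub_right,
      real_inner_self_eq_norm_sq, mul_pow, Real.norm_eq_abs, sq_abs, norm_sub_sq_real,
      real_inner_comm x y]
    ring
  generalize x + s • (y - x) = z at *
  have hb := hbot z
  induction hz : Ω z with
  | bot => exact absurd hz hb
  | top =>
    rw [hz] at h
    norm_cast at h
  | coe c =>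
    refine ⟨c, rfl, ?_⟩
    rw [hz] at h
    norm_cast at h
    rw [hn] at h
    linarith

/-- **Two-sided control of the suboptimality gap by the duality gap when `μ_Ω > 0`.**
With `σ_X = ‖X‖²_op`, `θ = −∇f(Xβ)`, `−θ ∈ dom f*` and `s = μ_Ω/(σ_X ν_f + μ_Ω)`:
`s·Gap(β,θ) ≤ P(β) − P(β̂) ≤ Gap(β,θ)`. -/
theorem two_sided_control_suboptimality_gap (n p : ℕ)
    (f : EuclideanSpace ℝ (Fin n) → ℝ) (hf_convex : ConvexOn ℝ Set.univ f)
    (gradf : EuclideanSpace ℝ (Fin n) → EuclideanSpace ℝ (Fin n))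
    (hgrad : ∀ x, HasGradientAt f (gradf x) x)
    (νf : ℝ) (hν : 0 ≤ νf)
    (hsmooth : ∀ x y, ‖gradf x - gradf y‖ ≤ νf * ‖x - y‖)
    (Ω : EuclideanSpace ℝ (Fin p) → EReal)
    (hΩ_ne_bot : ∀ x, Ω x ≠ ⊥) (hΩ_proper : ∃ x, Ω x ≠ ⊤)
    (hΩ_closed : LowerSemicontinuous Ω)
    (μΩ : ℝ) (hμ : 0 < μΩ)
    (hΩ_strong : ERealConvexOn (fun b => Ω b - ((μΩ / 2 * ‖b‖ ^ 2 : ℝ) : EReal)))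
    (X : Matrix (Fin n) (Fin p) ℝ)
    (βhat : EuclideanSpace ℝ (Fin p))
    (hmin : ∀ b, ((f (mv X βhat) : ℝ) : EReal) + Ω βhat ≤ ((f (mv X b) : ℝ) : EReal) + Ω b)
    (β : EuclideanSpace ℝ (Fin p)) (hβ_dom : Ω β ≠ ⊤)
    (θ : EuclideanSpace ℝ (Fin n)) (hθ : θ = -gradf (mv X β))
    (hθ_dom : fconjR f (-θ) ≠ ⊤) :
    letI σX : ℝ := (opNorm X) ^ 2
    letI s : ℝ := μΩ / (σX * νf + μΩ)
    letI P : EuclideanSpace ℝ (Fin p) → EReal := fun b => ((f (mv X b) : ℝ) : EReal) + Ω b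
    letI Gap : EReal := P β - (-(fconjR f (-θ)) - fconj Ω (mvT X θ))
    ((s : ℝ) : EReal) * Gap ≤ P β - P βhat ∧ P β - P βhat ≤ Gap := by
  set σX : ℝ := (opNorm X) ^ 2 with hσX
  set s : ℝ := μΩ / (σX * νf + μΩ) with hs
  have hσ : 0 ≤ σX := sq_nonneg _
  have hden : 0 < σX * νf + μΩ := by positivity
  have hs0 : 0 < s := div_pos hμ hden
  have hs1 : s ≤ 1 := (div_le_one hden).2 (by nlinarith [mul_nonneg hσ hν])
  have hsμ : s * (σX * νf + μΩ) = μΩ := div_mul_cancel₀ _ hden.ne'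
  obtain ⟨ωb, hωb⟩ : ∃ r : ℝ, Ω β = r :=
    ⟨(Ω β).toReal, (EReal.coe_toReal hβ_dom (hΩ_ne_bot β)).symm⟩
  have hhat_top : Ω βhat ≠ ⊤ := by
    intro h
    have := hmin β
    rw [h, hωb] at this
    norm_cast at this
  obtain ⟨ωh, hωh⟩ : ∃ r : ℝ, Ω βhat = r :=
    ⟨(Ω βhat).toReal, (EReal.coe_toReal hhat_top (hΩ_ne_bot βhat)).symm⟩
  have hmvsub : ∀ a b, mv X (a - b) = mv X a - mv X b := by
    intro a b
    simp only [aux_mv, map_sub]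
  have hfc : fconjR f (-θ)
      = ((inner ℝ (gradf (mv X β)) (mv X β) - f (mv X β) : ℝ) : EReal) := by
    rw [hθ, neg_neg]
    apply le_antisymm
    · refine iSup_le fun x => ?_
      rw [EReal.coe_le_coe_iff]
      have := aux_tangent f hf_convex gradf hgrad (mv X β) x
      rw [inner_sub_right] at this
      linarith
    · exact le_iSup (fun x => (((inner ℝ (gradf (mv X β)) x : ℝ) - f x : ℝ) : EReal)) (mv X β)
  have key : ∀ b : EuclideanSpace ℝ (Fin p), ∀ w : ℝ, Ω b = w →
      s * (ωb - w - inner ℝ (gradf (mv X β)) (mv X b - mv X β))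
        ≤ f (mv X β) + ωb - (f (mv X βhat) + ωh) := by
    intro b w hw
    obtain ⟨c, hc, hle⟩ := aux_strong Ω hΩ_ne_bot μΩ hΩ_strong β b ωb w hωb hw s hs0.le hs1
    have hm := hmin (β + s • (b - β))
    rw [hc, hωh] at hm
    norm_cast at hm
    have e : mv X (β + s • (b - β)) = mv X β + s • mv X (b - β) := by
      simp only [aux_mv, map_add, map_smul]
    have hd := aux_descent f gradf hgrad νf hsmooth (mv X β) (s • mv X (b - β))
    rw [← e, inner_smul_right, norm_smul, Real.norm_of_nonneg hs0.le] at hd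
    have hn : ‖mv X (b - β)‖ ≤ opNorm X * ‖b - β‖ := by
      rw [aux_mv]
      exact ContinuousLinearMap.le_opNorm _ _
    have hn2 : ‖mv X (b - β)‖ ^ 2 ≤ σX * ‖b - β‖ ^ 2 := by
      have := pow_le_pow_left₀ (norm_nonneg _) hn 2
      rwa [mul_pow] at this
    have hn3 : νf / 2 * (s * ‖mv X (b - β)‖) ^ 2 ≤ νf / 2 * s ^ 2 * (σX * ‖b - β‖ ^ 2) := by
      rw [mul_pow, ← mul_assoc]
      exact mul_le_mul_of_nonneg_left hn2 (by positivity)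
    have hz : μΩ / 2 * (s * (1 - s)) * ‖b - β‖ ^ 2 = νf / 2 * s ^ 2 * (σX * ‖b - β‖ ^ 2) := by
      linear_combination (-s / 2 * ‖b - β‖ ^ 2) * hsμ
    rw [← hmvsub]
    linarith
  have hconj_lb : ((inner ℝ (mvT X θ) βhat - ωh : ℝ) : EReal) ≤ fconj Ω (mvT X θ) := by
    have := le_iSup (fun x => ((inner ℝ (mvT X θ) x : ℝ) : EReal) - Ω x) βhat
    simp only [hωh] at this
    exact_mod_cast this
  have hin : ∀ b, inner ℝ (mvT X θ) b = - inner ℝ (gradf (mv X β)) (mv X b) := by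
    intro b
    rw [aux_mvT, hθ, inner_neg_left]
  have hconj_ub : fconj Ω (mvT X θ) ≤
      (((f (mv X β) + ωb - (f (mv X βhat) + ωh)) / s - ωb
        - inner ℝ (gradf (mv X β)) (mv X β) : ℝ) : EReal) := by
    refine iSup_le fun b => ?_
    have hb := hΩ_ne_bot b
    induction hw : Ω b with
    | bot => exact absurd hw hb
    | top => simp
    | coe w =>
      have hk := key b w hw
      rw [mul_comm, ← le_div_iff₀ hs0, inner_sub_right] at hk
      rw [hin]
      norm_cast
      linarith
  obtain ⟨q, hq⟩ : ∃ r : ℝ, fconj Ω (mvT X θ) = r := by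
    refine ⟨(fconj Ω (mvT X θ)).toReal, (EReal.coe_toReal ?_ ?_).symm⟩
    · exact (lt_of_le_of_lt hconj_ub (EReal.coe_lt_top _)).ne
    · exact (lt_of_lt_of_le (EReal.bot_lt_coe _) hconj_lb).ne'
  have ht := aux_tangent f hf_convex gradf hgrad (mv X β) (mv X βhat)
  rw [hq, EReal.coe_le_coe_iff] at hconj_lb hconj_ub
  rw [hin] at hconj_lb
  rw [inner_sub_right] at ht
  simp only [hq, hfc, hωb, hωh]
  norm_cast
  refine ⟨?_, ?_⟩
  · have h2 : q + ωb + inner ℝ (gradf (mv X β)) (mv X β)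
        ≤ (f (mv X β) + ωb - (f (mv X βhat) + ωh)) / s := by linarith
    rw [le_div_iff₀ hs0] at h2
    linarith
  · linarith
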